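/- Let m ≥ 2 be an integer and let r be the smallest index with w r ≥ m. If c, d : ℝ satisfy c³ = c² + 1 and 31d³ - 31d² + 9d = 1, then d·c^(r-1) < m and consequently r < (log m - log d)/(log c) + 1, i.e., r < log_c m - log_c d + 1. -/

import Mathlib

/-- Narayana's cows sequence: `w 0 = w 1 = w 2 = 1` and `w i = w (i-1) + w (i-3)` for `i ≥ 3`. -/
def narayana : ℕ → ℕ
  | 0 => 1
  | 1 => 1
  | 2 => 1
  | (n + 3) => narayana (n + 2) + narayana n

lemma bounds_of_cube_eq_sq_add_one {c : ℝ} (hc : c ^ 3 = c ^ 2 + 1) :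
    1.46 < c ∧ c < 1.47 := by
  have h1 : 1 < c := by
    by_contra! h
    nlinarith [mul_nonneg (sq_nonneg c) (sub_nonneg.2 h)]
  constructor
  · by_contra! h
    nlinarith [mul_nonneg (sub_nonneg.2 h) (sub_nonneg.2 h1.le),
      mul_nonneg (sq_nonneg c) (sub_nonneg.2 h)]
  · by_contra! h
    nlinarith [mul_nonneg (sub_nonneg.2 h) (sub_nonneg.2 h1.le),
      mul_nonneg (sq_nonneg c) (sub_nonneg.2 h)]

/-- The leading coefficient of the Binet formula for `narayana` in terms of its growth rate. -/
lemma leading_coeff_eq_div {c d : ℝ} (hc : c ^ 3 = c ^ 2 + 1)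
    (hd : 31 * d ^ 3 - 31 * d ^ 2 + 9 * d = 1) : d = c / (3 * c - 2) := by
  obtain ⟨hl, hu⟩ := bounds_of_cube_eq_sq_add_one hc
  have hpos : 0 < 3 * c - 2 := by linarith
  set t := c / (3 * c - 2) with ht
  have ht' : 31 * t ^ 3 - 31 * t ^ 2 + 9 * t = 1 := by
    have hne : (3 * c - 2) ^ 3 ≠ 0 := by positivity
    have hm : t * (3 * c - 2) = c := div_mul_cancel₀ c hpos.ne'
    apply mul_left_cancel₀ hne
    linear_combination (-8 : ℝ) * hc + (31 * ((t * (3 * c - 2)) ^ 2 + t * (3 * c - 2) * c + c ^ 2)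
      - 31 * (3 * c - 2) * (t * (3 * c - 2) + c) + 9 * (3 * c - 2) ^ 2) * hm
  have htl : 0.6 < t := by rw [ht, lt_div_iff₀ hpos]; linarith
  have htu : t < 0.62 := by rw [ht, div_lt_iff₀ hpos]; linarith
  have hmul : (d - t) * (31 * (d ^ 2 + d * t + t ^ 2) - 31 * (d + t) + 9) = 0 := by
    linear_combination hd - ht'
  rcases mul_eq_zero.1 hmul with h | h
  · linarith
  · nlinarith [sq_nonneg (2 * d + t - 1), mul_pos (sub_pos.2 htl) (sub_pos.2 htu)]

lemma narayana_sub_mul_pow_rec {c d : ℝ} (hc : c ^ 3 = c ^ 2 + 1)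
    (hd : d * (3 * c - 2) = c) (n : ℕ) :
    (narayana (n + 2) - d * c ^ (n + 2)) + (c - 1) * (narayana (n + 1) - d * c ^ (n + 1)) +
      c * (c - 1) * (narayana n - d * c ^ n) = 0 := by
  induction n with
  | zero =>
    simp only [narayana, zero_add]
    push_cast
    linear_combination (-c) * hd
  | succ n ih =>
    have h : (narayana (n + 3) : ℝ) = narayana (n + 2) + narayana n := by
      simp [narayana]
    rw [show n + 1 + 2 = n + 3 from rfl, show n + 1 + 1 = n + 2 from rfl, h]
    linear_combination c * ih - narayana n * hc

lemma abs_narayana_sub_mul_pow_lt_one {c d : ℝ} (hc : c ^ 3 = c ^ 2 + 1)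
    (hd : d * (3 * c - 2) = c) (n : ℕ) : |narayana n - d * c ^ n| < 1 := by
  obtain ⟨hl, hu⟩ := bounds_of_cube_eq_sq_add_one hc
  have hdl : 0.6 < d := by nlinarith
  have hdu : d < 0.62 := by nlinarith
  induction n using Nat.strong_induction_on with
  | _ n ih =>
    match n with
    | 0 => simp only [narayana, abs_lt]; push_cast; constructor <;> linarith
    | 1 => simp only [narayana, abs_lt]; push_cast; constructor <;> nlinarith
    | 2 => simp only [narayana, abs_lt]; push_cast; constructor <;> nlinarith
    | n + 3 =>
      have h0 := abs_lt.1 (ih n (by omega))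
      have h1 := abs_lt.1 (ih (n + 1) (by omega))
      have r0 := narayana_sub_mul_pow_rec hc hd n
      have r1 := narayana_sub_mul_pow_rec hc hd (n + 1)
      rw [show n + 1 + 2 = n + 3 from rfl, show n + 1 + 1 = n + 2 from rfl] at r1
      generalize (narayana n : ℝ) - d * c ^ n = x at *
      generalize (narayana (n + 1) : ℝ) - d * c ^ (n + 1) = y at *
      generalize (narayana (n + 2) : ℝ) - d * c ^ (n + 2) = z at *
      generalize (narayana (n + 3) : ℝ) - d * c ^ (n + 3) = u at *
      have hu' : u = -(c - 1) * y + c * (c - 1) ^ 2 * x := by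
        linear_combination r1 - (c - 1) * r0
      have hb : c * (c - 1) ^ 2 < 0.4 := by nlinarith
      have hb0 : 0 < c * (c - 1) ^ 2 := by
        have : 0 < c - 1 := by linarith
        positivity
      rw [hu', abs_lt]
      constructor <;> nlinarith

/-- Let `m ≥ 2` be an integer and let `r` be the smallest index with `w r ≥ m`.
If `c³ = c² + 1` and `31d³ - 31d² + 9d = 1`, then `d·c^(r-1) < m`, and consequently
`r < log_c m - log_c d + 1` where `log_c x = (log x)/(log c)`. -/
theorem narayana_least_index_bound (m : ℕ) (hm : 2 ≤ m) (r : ℕ)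
    (hr : IsLeast {i : ℕ | m ≤ narayana i} r)
    (c d : ℝ) (hc : c ^ 3 = c ^ 2 + 1) (hd : 31 * d ^ 3 - 31 * d ^ 2 + 9 * d = 1) :
    d * c ^ (r - 1) < (m : ℝ) ∧
      (r : ℝ) < (Real.log m - Real.log d) / Real.log c + 1 := by
  obtain ⟨hl, hu⟩ := bounds_of_cube_eq_sq_add_one hc
  have hpos : 0 < 3 * c - 2 := by linarith
  have hdc := leading_coeff_eq_div hc hd
  have hd0 : 0 < d := by rw [hdc]; exact div_pos (by linarith) hpos
  have hd' : d * (3 * c - 2) = c := by rw [hdc]; exact div_mul_cancel₀ c hpos.ne'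
  have hr0 : r ≠ 0 := by
    rintro rfl
    have h : m ≤ narayana 0 := hr.1
    simp only [narayana] at h
    omega
  have hlt : narayana (r - 1) < m := by
    by_contra! h
    have : r ≤ r - 1 := hr.2 h
    omega
  have hmain : d * c ^ (r - 1) < (m : ℝ) := by
    have h1 := (abs_lt.1 (abs_narayana_sub_mul_pow_lt_one hc hd' (r - 1))).1
    have h2 : (narayana (r - 1) : ℝ) + 1 ≤ m := by exact_mod_cast hlt
    linarith
  refine ⟨hmain, ?_⟩
  have hc0 : 0 < c ^ (r - 1) := pow_pos (by linarith) _
  have hlog := Real.log_lt_log (mul_pos hd0 hc0) hmain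
  rw [Real.log_mul hd0.ne' hc0.ne', Real.log_pow,
    Nat.cast_sub (Nat.one_le_iff_ne_zero.2 hr0), Nat.cast_one] at hlog
  rw [← sub_lt_iff_lt_add, lt_div_iff₀ (Real.log_pos (by linarith))]
  linarith
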